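/- arXiv:1902.08719 — 2 statements merged into one kernel-verified Lean document; each statement's English description precedes it below -/
import Mathlib

section
/- Let H be a connected hypergraph satisfying Condition (LV) and K a field. Then L_K(H) is a prime ring: L_K(H) is nonzero and for all x,y ∈ L_K(H), xL_K(H)y = {0} implies x = 0 or y = 0. -/
open scoped Classical

/-- The generators of the Leavitt path algebra of a hypergraph `H = (H0, H1, s, r)`:
a vertex generator `v` for every `v ∈ H0`, and generators `h_{ij}` (`edge`) and
`h_{ij}^*` (`ghost`) for every hyperedge `h ∈ H1`, `1 ≤ i ≤ |s(h)|`, `1 ≤ j ≤ |r(h)|`.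
The multisets `s(h)` and `r(h)` are given as (enumerated) lists over `H0`. -/
inductive HGen (H0 H1 : Type) (s r : H1 → List H0) : Type
  | vertex (v : H0) : HGen H0 H1 s r
  | edge (h : H1) (i : Fin (s h).length) (j : Fin (r h).length) : HGen H0 H1 s r
  | ghost (h : H1) (i : Fin (s h).length) (j : Fin (r h).length) : HGen H0 H1 s r

namespace HLPA

variable (K : Type) [Field K] (H0 H1 : Type) (s r : H1 → List H0)

/-- The defining relations (i)-(iv) of the Leavitt path algebra of a hypergraph,
imposed on the free algebra on the generators. -/
inductive Rel : FreeAlgebra K (HGen H0 H1 s r) → FreeAlgebra K (HGen H0 H1 s r) → Prop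
  | vtx (u v : H0) :
      Rel (FreeAlgebra.ι K (HGen.vertex u : HGen H0 H1 s r) * FreeAlgebra.ι K (HGen.vertex v))
        (if u = v then FreeAlgebra.ι K (HGen.vertex u : HGen H0 H1 s r) else 0)
  | src_edge (h : H1) (i : Fin (s h).length) (j : Fin (r h).length) :
      Rel (FreeAlgebra.ι K (HGen.vertex ((s h).get i) : HGen H0 H1 s r) *
            FreeAlgebra.ι K (HGen.edge h i j))
        (FreeAlgebra.ι K (HGen.edge h i j))
  | edge_rng (h : H1) (i : Fin (s h).length) (j : Fin (r h).length) :
      Rel (FreeAlgebra.ι K (HGen.edge h i j : HGen H0 H1 s r) *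
            FreeAlgebra.ι K (HGen.vertex ((r h).get j)))
        (FreeAlgebra.ι K (HGen.edge h i j))
  | rng_ghost (h : H1) (i : Fin (s h).length) (j : Fin (r h).length) :
      Rel (FreeAlgebra.ι K (HGen.vertex ((r h).get j) : HGen H0 H1 s r) *
            FreeAlgebra.ι K (HGen.ghost h i j))
        (FreeAlgebra.ι K (HGen.ghost h i j))
  | ghost_src (h : H1) (i : Fin (s h).length) (j : Fin (r h).length) :
      Rel (FreeAlgebra.ι K (HGen.ghost h i j : HGen H0 H1 s r) *
            FreeAlgebra.ι K (HGen.vertex ((s h).get i)))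
        (FreeAlgebra.ι K (HGen.ghost h i j))
  | cuntz1 (h : H1) (i i' : Fin (s h).length) :
      Rel (∑ k : Fin (r h).length,
            FreeAlgebra.ι K (HGen.edge h i k : HGen H0 H1 s r) *
              FreeAlgebra.ι K (HGen.ghost h i' k))
        (if i = i' then FreeAlgebra.ι K (HGen.vertex ((s h).get i) : HGen H0 H1 s r) else 0)
  | cuntz2 (h : H1) (j j' : Fin (r h).length) :
      Rel (∑ k : Fin (s h).length,
            FreeAlgebra.ι K (HGen.ghost h k j : HGen H0 H1 s r) *
              FreeAlgebra.ι K (HGen.edge h k j'))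
        (if j = j' then FreeAlgebra.ι K (HGen.vertex ((r h).get j) : HGen H0 H1 s r) else 0)

/-- The universal unital algebra on the generators subject to the relations (i)-(iv);
it is the unitalization of the Leavitt path algebra of the hypergraph. -/
abbrev Ambient : Type := RingQuot (Rel K H0 H1 s r)

/-- The image of a generator in the ambient algebra. -/
noncomputable def amb (g : HGen H0 H1 s r) : Ambient K H0 H1 s r :=
  RingQuot.mkAlgHom K (Rel K H0 H1 s r) (FreeAlgebra.ι K g)

/-- The Leavitt path algebra of the hypergraph `(H0, H1, s, r)`, realized as the
non-unital subalgebra generated by the generators inside the universal unital algebra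
on the generators subject to the relations (i)-(iv). (This is the algebra presented,
in the category of not necessarily unital `K`-algebras, by said generators and
relations.) -/
noncomputable def LPAsub : NonUnitalSubalgebra K (Ambient K H0 H1 s r) :=
  NonUnitalAlgebra.adjoin K (Set.range (amb K H0 H1 s r))

/-- The Leavitt path algebra `L_K(H)` of the hypergraph `H = (H0, H1, s, r)`. -/
abbrev LPA : Type := ↥(LPAsub K H0 H1 s r)

variable {H0 H1 s r}

/-- A generator, as an element of the Leavitt path algebra. -/
noncomputable def genL (g : HGen H0 H1 s r) : LPA K H0 H1 s r :=
  ⟨amb K H0 H1 s r g, NonUnitalAlgebra.subset_adjoin K (Set.mem_range_self g)⟩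

/-- The vertex generator `v ∈ H0` as an element of the Leavitt path algebra. -/
noncomputable def vgen (v : H0) : LPA K H0 H1 s r := genL K (HGen.vertex v)

/-- The generator `h_{ij}` as an element of the Leavitt path algebra. -/
noncomputable def egen (h : H1) (i : Fin (s h).length) (j : Fin (r h).length) :
    LPA K H0 H1 s r := genL K (HGen.edge h i j)

/-- The generator `h_{ij}^*` as an element of the Leavitt path algebra. -/
noncomputable def ggen (h : H1) (i : Fin (s h).length) (j : Fin (r h).length) :
    LPA K H0 H1 s r := genL K (HGen.ghost h i j)

end HLPA

namespace HLPA

variable (K : Type) [Field K] (H0 H1 : Type) (s r : H1 → List H0)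

noncomputable instance instLPANonUnitalRing : NonUnitalRing (LPA K H0 H1 s r) :=
  NonUnitalSubalgebra.toNonUnitalRing (LPAsub K H0 H1 s r)

noncomputable instance instLPAAddCommGroup : AddCommGroup (LPA K H0 H1 s r) :=
  (instLPANonUnitalRing K H0 H1 s r).toAddCommGroup

noncomputable instance instLPAModule : Module K (LPA K H0 H1 s r) :=
  (LPAsub K H0 H1 s r).instModule

end HLPA

namespace HLPA

variable {H0 H1 : Type} {s r : H1 → List H0}

/-- The source vertex of a letter (edge, ghost edge or vertex) in the double graph of
the directed graph associated to the hypergraph. -/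
def letterSrc : HGen H0 H1 s r → H0
  | .vertex v => v
  | .edge h i _ => (s h).get i
  | .ghost h _ j => (r h).get j

/-- The range vertex of a letter in the double graph of the directed graph associated
to the hypergraph. -/
def letterRng : HGen H0 H1 s r → H0
  | .vertex v => v
  | .edge h _ j => (r h).get j
  | .ghost h i _ => (s h).get i

/-- Whether a letter is a vertex letter. -/
def IsVertexLetter : HGen H0 H1 s r → Prop
  | .vertex _ => True
  | _ => False

/-- A d-path: a path in the double graph of the directed graph associated to the
hypergraph, i.e. either a single vertex (length `0`), or a nonempty word of edges and
ghost edges in which the range of each letter is the source of the next one. -/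
def IsDPath (l : List (HGen H0 H1 s r)) : Prop :=
  (∃ v : H0, l = [HGen.vertex v]) ∨
    (l ≠ [] ∧ (∀ x ∈ l, ¬ IsVertexLetter x) ∧
      l.Chain' fun x y => letterRng x = letterSrc y)

/-- The forbidden two-letter words `h_{i1} h_{j1}^*` and `h_{1i}^* h_{1j}`
(indices here are `0`-based, so `1` becomes `0`). -/
def Forbidden : HGen H0 H1 s r → HGen H0 H1 s r → Prop
  | .edge h _ j, .ghost h' _ j' => h = h' ∧ (j : ℕ) = 0 ∧ (j' : ℕ) = 0
  | .ghost h i _, .edge h' i' _ => h = h' ∧ (i : ℕ) = 0 ∧ (i' : ℕ) = 0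
  | _, _ => False

/-- A nod-path (normal d-path): a d-path none of whose subwords is forbidden. -/
def IsNodPath (l : List (HGen H0 H1 s r)) : Prop :=
  IsDPath l ∧ l.Chain' fun x y => ¬ Forbidden x y

/-- The length of a d-path: `0` for a single vertex, and the word length otherwise. -/
def nodLength : List (HGen H0 H1 s r) → ℕ
  | [HGen.vertex _] => 0
  | l => l.length

variable (K : Type) [Field K]

/-- The image of a word over the generators in the Leavitt path algebra
(the product of its letters; junk value `0` for the empty word). -/
noncomputable def wordProd : List (HGen H0 H1 s r) → LPA K H0 H1 s r
  | [] => 0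
  | [g] => genL K g
  | g :: g' :: t => genL K g * wordProd (g' :: t)

end HLPA

namespace HalfEdge

/-- Combinatorial data of a hypergraph seen through its oriented hyperedges `t : T`: reversal of
the orientation, the size of the source multiset of `t`, and its members. -/
structure Sys (T V : Type) where
  flip : T → T
  flip_flip : ∀ t, flip (flip t) = t
  card : T → ℕ
  two_le : ∀ t, 2 ≤ card t
  vtx : T → ℕ → V

/-- An edge of the double graph: it leads from the `a`-th source to the `b`-th range of `t`. -/
@[ext]
structure Letter (T : Type) where
  t : T
  a : ℕ
  b : ℕ

/-- Words of letters together with an end vertex. -/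
abbrev Word (T V : Type) : Type := List (Letter T) × V

namespace Sys

variable {T V : Type} (S : Sys T V)

/-- The indices of a letter are within bounds. -/
def Valid (x : Letter T) : Prop := x.a < S.card x.t ∧ x.b < S.card (S.flip x.t)

/-- The source of a letter. -/
def src (x : Letter T) : V := S.vtx x.t x.a

/-- The range of a letter. -/
def rng (x : Letter T) : V := S.vtx (S.flip x.t) x.b

/-- The source of a word. -/
def start : List (Letter T) → V → V
  | [], w => w
  | x :: _, _ => S.src x

/-- The forbidden two-letter words. -/
def Bad (x y : Letter T) : Prop := y.t = S.flip x.t ∧ x.b = 0 ∧ y.a = 0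

/-- Composable words without forbidden subwords. -/
def Normal : List (Letter T) → V → Prop
  | [], _ => True
  | x :: l, w => S.Valid x ∧ S.rng x = S.start l w ∧ (∀ y ∈ l.head?, ¬ S.Bad x y) ∧ Normal l w

variable {S}

theorem Normal.change_source {t : T} {a a' b : ℕ} {l : List (Letter T)} {w : V}
    (h : S.Normal (⟨t, a, b⟩ :: l) w) (ha : a' < S.card t) : S.Normal (⟨t, a', b⟩ :: l) w :=
  ⟨⟨ha, h.1.2⟩, h.2⟩

theorem Normal.cons_pair {t : T} {a c k d : ℕ} {l : List (Letter T)} {w : V}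
    (h : S.Normal (⟨S.flip t, c, d⟩ :: l) w) (ha : a < S.card t) (hk : 1 ≤ k)
    (hk' : k < S.card (S.flip t)) : S.Normal (⟨t, a, k⟩ :: ⟨S.flip t, k, d⟩ :: l) w := by
  refine ⟨⟨ha, hk'⟩, rfl, ?_, h.change_source hk'⟩
  intro y _ hb
  have : k = 0 := hb.2.1
  omega

theorem Normal.append_replace {x x' : Letter T} {l₀ l' : List (Letter T)} {u w : V}
    (h : S.Normal (l₀ ++ [x]) u) (h' : S.Normal (x' :: l') w) (ht : x'.t = x.t)
    (ha : x'.a = x.a) : S.Normal (l₀ ++ x' :: l') w := by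
  induction l₀ with
  | nil => exact h'
  | cons y l₀ ih =>
    obtain ⟨h1, h2, h3, h4⟩ := h
    refine ⟨h1, ?_, ?_, ih h4⟩
    · cases l₀ with
      | nil => simpa [start, src, ht, ha] using h2
      | cons z l₁ => exact h2
    · cases l₀ with
      | nil => simpa [Bad, ht, ha] using h3
      | cons z l₁ => exact h3

theorem Normal.append {l l' : List (Letter T)} {u w : V} (h : S.Normal l u) (h' : S.Normal l' w)
    (hu : u = S.start l' w) (hb : ∀ l₀ x y l₁, l = l₀ ++ [x] → l' = y :: l₁ → ¬ S.Bad x y) :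
    S.Normal (l ++ l') w := by
  induction l with
  | nil => exact h'
  | cons x l ih =>
    obtain ⟨h1, h2, h3, h4⟩ := h
    refine ⟨h1, ?_, ?_, ih h4 fun l₀ z y l₁ hl => hb (x :: l₀) z y l₁ (by simp [hl])⟩
    · cases l with
      | nil => exact h2.trans hu
      | cons z l => exact h2
    · cases l with
      | nil =>
        intro y hy
        cases l' with
        | nil => simp at hy
        | cons y' l' =>
          have : y' = y := by simpa using hy
          subst this
          exact hb [] x _ _ rfl rfl
      | cons z l => exact h3

theorem Normal.of_append_right {l l' : List (Letter T)} {w : V} (h : S.Normal (l ++ l') w) :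
    S.Normal l' w := by
  induction l with
  | nil => exact h
  | cons x l ih => exact ih h.2.2.2

variable (S) (K : Type) [Field K]

/-- The basis vector of a word. -/
noncomputable abbrev e {T V : Type} (K : Type) [Field K] (l : List (Letter T)) (w : V) :
    Word T V →₀ K := Finsupp.single (l, w) 1

/-- Left multiplication of a normal word by a letter, rewritten in normal form. -/
noncomputable def act (x : Letter T) : Word T V → (Word T V →₀ K)
  | (l, w) =>
    if S.Valid x ∧ S.rng x = S.start l w ∧ S.Normal l w then
      match l with
      | [] => e K [x] w
      | y :: l' =>
        if S.Bad x y then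
          (if x.a = y.b then e K l' w else 0) -
            ∑ k ∈ Finset.Ico 1 (S.card (S.flip x.t)),
              e K (⟨x.t, x.a, k⟩ :: ⟨S.flip x.t, k, y.b⟩ :: l') w
        else e K (x :: y :: l') w
    else 0

/-- The operator of left multiplication by a letter. -/
noncomputable def X (x : Letter T) : Module.End K (Word T V →₀ K) :=
  Finsupp.linearCombination K (S.act K x)

/-- The operator of left multiplication by a vertex. -/
noncomputable def P (u : V) : Module.End K (Word T V →₀ K) :=
  Finsupp.linearCombination K fun q : Word T V =>
    if S.Normal q.1 q.2 ∧ S.start q.1 q.2 = u then e K q.1 q.2 else 0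

variable {S K}

theorem P_e {l : List (Letter T)} {w : V} (h : S.Normal l w) (u : V) :
    S.P K u (e K l w) = if S.start l w = u then e K l w else 0 := by
  simp [P, e, h]

theorem P_e_of_not_normal {l : List (Letter T)} {w : V} (h : ¬ S.Normal l w) (u : V) :
    S.P K u (e K l w) = 0 := by
  simp [P, e, h]

theorem X_e_of_not {x : Letter T} {l : List (Letter T)} {w : V}
    (h : ¬ (S.Valid x ∧ S.rng x = S.start l w ∧ S.Normal l w)) : S.X K x (e K l w) = 0 := by
  simp only [X, e, Finsupp.linearCombination_single, act, if_neg h, smul_zero]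

theorem X_e_of_normal {x : Letter T} {l : List (Letter T)} {w : V} (h : S.Normal (x :: l) w) :
    S.X K x (e K l w) = e K (x :: l) w := by
  obtain ⟨h1, h2, h3, h4⟩ := h
  have hc : S.Valid x ∧ S.rng x = S.start l w ∧ S.Normal l w := ⟨h1, h2, h4⟩
  simp only [X, e, Finsupp.linearCombination_single, act, if_pos hc, one_smul]
  cases l with
  | nil => rfl
  | cons y l => exact if_neg (h3 y rfl)

theorem X_e_of_bad {t : T} {a d : ℕ} {l : List (Letter T)} {w : V}
    (h : S.Normal (⟨S.flip t, 0, d⟩ :: l) w) (ha : a < S.card t) :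
    S.X K ⟨t, a, 0⟩ (e K (⟨S.flip t, 0, d⟩ :: l) w) =
      (if a = d then e K l w else 0) - ∑ k ∈ Finset.Ico 1 (S.card (S.flip t)),
        e K (⟨t, a, k⟩ :: ⟨S.flip t, k, d⟩ :: l) w := by
  have hc : S.Valid ⟨t, a, 0⟩ ∧ S.rng ⟨t, a, 0⟩ = S.start (⟨S.flip t, 0, d⟩ :: l) w ∧
      S.Normal (⟨S.flip t, 0, d⟩ :: l) w := ⟨⟨ha, h.1.1⟩, rfl, h⟩
  have hb : S.Bad ⟨t, a, 0⟩ ⟨S.flip t, 0, d⟩ := ⟨rfl, rfl, rfl⟩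
  simp only [X, e, Finsupp.linearCombination_single, act, if_pos hc, if_pos hb, one_smul]

/-- The three possible shapes of the product of a letter and a word. -/
theorem X_e_cases (x : Letter T) (l : List (Letter T)) (w : V) :
    (¬ (S.Valid x ∧ S.rng x = S.start l w ∧ S.Normal l w)) ∨ S.Normal (x :: l) w ∨
      ∃ t a d l', x = ⟨t, a, 0⟩ ∧ l = ⟨S.flip t, 0, d⟩ :: l' ∧ a < S.card t ∧ S.Normal l w := by
  by_cases h : S.Valid x ∧ S.rng x = S.start l w ∧ S.Normal l w
  · by_cases hb : ∀ y ∈ l.head?, ¬ S.Bad x y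
    · exact .inr (.inl ⟨h.1, h.2.1, hb, h.2.2⟩)
    · push Not at hb
      obtain ⟨y, hy, hb⟩ := hb
      refine .inr (.inr ⟨x.t, x.a, y.b, l.tail, ?_, ?_, h.1.1, h.2.2⟩)
      · exact Letter.ext rfl rfl hb.2.1
      · cases l with
        | nil => simp at hy
        | cons z l =>
          have : z = y := by simpa using hy
          subst this
          simp only [List.tail_cons, List.cons.injEq, and_true]
          exact Letter.ext hb.1 hb.2.2 rfl
  · exact .inl h

theorem P_comp_X (x : Letter T) : S.P K (S.src x) * S.X K x = S.X K x := by
  refine Finsupp.lhom_ext' fun q => LinearMap.ext_ring ?_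
  obtain ⟨l, w⟩ := q
  change S.P K (S.src x) (S.X K x (e K l w)) = S.X K x (e K l w)
  rcases S.X_e_cases x l w with h | h | ⟨t, a, d, l', rfl, rfl, ha, h⟩
  · simp [X_e_of_not h]
  · rw [X_e_of_normal h, P_e h, if_pos (by rfl)]
  · rw [X_e_of_bad h ha, map_sub, map_sum]
    congr 1
    · split_ifs with had
      · subst had
        rw [P_e h.2.2.2, if_pos]
        rw [← h.2.1]
        simp [rng, src, S.flip_flip]
      · simp
    · refine Finset.sum_congr rfl fun k hk => ?_
      rw [Finset.mem_Ico] at hk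
      rw [P_e (h.cons_pair ha hk.1 hk.2), if_pos (by rfl)]

theorem X_comp_P (x : Letter T) : S.X K x * S.P K (S.rng x) = S.X K x := by
  refine Finsupp.lhom_ext' fun q => LinearMap.ext_ring ?_
  obtain ⟨l, w⟩ := q
  change S.X K x (S.P K (S.rng x) (e K l w)) = S.X K x (e K l w)
  by_cases h : S.Normal l w
  · rw [P_e h]
    split_ifs with h'
    · rfl
    · rw [map_zero, X_e_of_not fun H => h' H.2.1.symm]
  · rw [P_e_of_not_normal h, map_zero, X_e_of_not fun H => h H.2.2]

theorem P_comp_P (u v : V) : S.P K u * S.P K v = if u = v then S.P K u else 0 := by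
  refine Finsupp.lhom_ext' fun q => LinearMap.ext_ring ?_
  obtain ⟨l, w⟩ := q
  change S.P K u (S.P K v (e K l w)) = (if u = v then S.P K u else 0) (e K l w)
  by_cases h : S.Normal l w
  · rw [P_e h]
    split_ifs with h1 h2 h2
    · rfl
    · rw [P_e h, if_neg fun h3 => h2 (h3.symm.trans h1)]; rfl
    · rw [P_e h, if_neg fun h3 => h1 (h3.trans h2), map_zero]
    · rw [map_zero]; rfl
  · rw [P_e_of_not_normal h, map_zero]
    split_ifs
    · rw [P_e_of_not_normal h]
    · rfl

theorem sum_range_card {M : Type} [AddCommMonoid M] (t : T) (f : ℕ → M) :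
    ∑ k ∈ Finset.range (S.card t), f k = f 0 + ∑ k ∈ Finset.Ico 1 (S.card t), f k := by
  have := S.two_le t
  rw [Finset.range_eq_Ico, Finset.sum_eq_sum_Ico_succ_bot (by omega)]

/-- The relation `∑ₖ hₐₖ h*ₖ꜀ = δₐ꜀` on words which may be multiplied by the `h*ₖ꜀`. -/
theorem sum_X_X_e_of_normal {t : T} {a c : ℕ} {l : List (Letter T)} {w : V} (ha : a < S.card t)
    (h : ∀ k < S.card (S.flip t), S.Normal (⟨S.flip t, k, c⟩ :: l) w) :
    ∑ k ∈ Finset.range (S.card (S.flip t)),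
      S.X K ⟨t, a, k⟩ (S.X K ⟨S.flip t, k, c⟩ (e K l w)) = if a = c then e K l w else 0 := by
  have h0 := S.two_le (S.flip t)
  rw [sum_range_card, X_e_of_normal (h 0 (by omega)), X_e_of_bad (h 0 (by omega)) ha,
    sub_add_eq_add_sub, sub_eq_iff_eq_add]
  congr 1
  refine Finset.sum_congr rfl fun k hk => ?_
  rw [Finset.mem_Ico] at hk
  rw [X_e_of_normal (h k hk.2), X_e_of_normal ((h k hk.2).cons_pair ha hk.1 hk.2)]

theorem sum_X_X {t : T} {a c : ℕ} (ha : a < S.card t) (hc : c < S.card t) :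
    ∑ k ∈ Finset.range (S.card (S.flip t)), S.X K ⟨t, a, k⟩ * S.X K ⟨S.flip t, k, c⟩ =
      if a = c then S.P K (S.vtx t a) else 0 := by
  refine Finsupp.lhom_ext' fun q => LinearMap.ext_ring ?_
  obtain ⟨l, w⟩ := q
  rw [LinearMap.comp_apply, LinearMap.comp_apply, LinearMap.sum_apply]
  change ∑ k ∈ Finset.range (S.card (S.flip t)),
    S.X K ⟨t, a, k⟩ (S.X K ⟨S.flip t, k, c⟩ (e K l w)) =
      (if a = c then S.P K (S.vtx t a) else 0) (e K l w)
  have hval : ∀ k < S.card (S.flip t), S.Valid ⟨S.flip t, k, c⟩ := fun k hk =>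
    ⟨hk, by simpa [S.flip_flip] using hc⟩
  have hrng : ∀ k, S.rng ⟨S.flip t, k, c⟩ = S.vtx t c := fun k => by simp [rng, S.flip_flip]
  by_cases hn : S.Normal l w ∧ S.start l w = S.vtx t c
  · obtain ⟨hl, hst⟩ := hn
    have hR : (if a = c then S.P K (S.vtx t a) else 0) (e K l w) =
        if a = c then e K l w else 0 := by
      split_ifs with hac
      · rw [P_e hl, hac, if_pos hst]
      · rfl
    rw [hR]
    by_cases hb : ∀ y ∈ l.head?, ¬ (y.t = t ∧ c = 0 ∧ y.a = 0)
    · refine sum_X_X_e_of_normal ha fun k hk => ⟨hval k hk, (hrng k).trans hst.symm, ?_, hl⟩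
      intro y hy
      simpa [Bad, S.flip_flip] using hb y hy
    · push Not at hb
      obtain ⟨⟨t', a', m⟩, hy, ht, rfl, ha'⟩ := hb
      obtain ⟨l', rfl⟩ : ∃ l', l = ⟨t', a', m⟩ :: l' := by
        cases l with
        | nil => simp at hy
        | cons z l => exact ⟨l, by simpa using hy⟩
      simp only at ht ha'
      subst ht ha'
      have hm : m < S.card (S.flip t') := hl.1.2
      have hX : ∀ k ∈ Finset.range (S.card (S.flip t')),
          S.X K ⟨S.flip t', k, 0⟩ (e K (⟨t', 0, m⟩ :: l') w) =
            (if k = m then e K l' w else 0) - ∑ j ∈ Finset.Ico 1 (S.card t'),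
              e K (⟨S.flip t', k, j⟩ :: ⟨t', j, m⟩ :: l') w := by
        intro k hk
        rw [Finset.mem_range] at hk
        have := X_e_of_bad (K := K) (t := S.flip t') (a := k) (d := m) (l := l') (w := w)
          (by simpa [S.flip_flip] using hl) hk
        simpa only [S.flip_flip] using this
      rw [Finset.sum_congr rfl fun k hk => by rw [hX k hk, map_sub, map_sum],
        Finset.sum_sub_distrib, Finset.sum_comm]
      have h1 : ∑ k ∈ Finset.range (S.card (S.flip t')),
          S.X K ⟨t', a, k⟩ (if k = m then e K l' w else 0) = e K (⟨t', a, m⟩ :: l') w := by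
        rw [Finset.sum_eq_single m]
        · rw [if_pos rfl, X_e_of_normal (hl.change_source ha)]
        · intro k _ hk
          rw [if_neg hk, map_zero]
        · intro h
          exact absurd (Finset.mem_range.2 hm) h
      have h2 : ∀ j ∈ Finset.Ico 1 (S.card t'), ∑ k ∈ Finset.range (S.card (S.flip t')),
          S.X K ⟨t', a, k⟩ (e K (⟨S.flip t', k, j⟩ :: ⟨t', j, m⟩ :: l') w) =
            if a = j then e K (⟨t', j, m⟩ :: l') w else 0 := by
        intro j hj
        rw [Finset.mem_Ico] at hj
        have hN : ∀ k < S.card (S.flip t'),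
            S.Normal (⟨S.flip t', k, j⟩ :: ⟨t', j, m⟩ :: l') w := by
          intro k hk
          have hl' : S.Normal (⟨S.flip (S.flip t'), 0, m⟩ :: l') w := by
            rw [S.flip_flip]; exact hl
          have := hl'.cons_pair hk hj.1 (by rw [S.flip_flip]; exact hj.2)
          rwa [S.flip_flip] at this
        rw [← sum_X_X_e_of_normal ha hN]
        refine Finset.sum_congr rfl fun k hk => ?_
        rw [X_e_of_normal (hN k (Finset.mem_range.1 hk))]
      rw [h1, Finset.sum_congr rfl h2, Finset.sum_ite_eq]
      simp only [Finset.mem_Ico]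
      by_cases ha0 : a = 0
      · subst ha0
        simp
      · rw [if_pos ⟨by omega, ha⟩, if_neg ha0, sub_self]
  · have hL : ∀ k ∈ Finset.range (S.card (S.flip t)),
        S.X K ⟨t, a, k⟩ (S.X K ⟨S.flip t, k, c⟩ (e K l w)) = 0 := fun k _ => by
      rw [X_e_of_not fun H => hn ⟨H.2.2, (H.2.1.symm.trans (hrng k))⟩, map_zero]
    rw [Finset.sum_eq_zero hL]
    split_ifs with hac
    · subst hac
      by_cases hl : S.Normal l w
      · rw [P_e hl, if_neg fun h => hn ⟨hl, h⟩]
      · rw [P_e_of_not_normal hl]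
    · rfl

variable (S K) in
/-- Elements of an algebra satisfying the relations of the Leavitt path algebra. -/
structure Rep (R : Type) [Ring R] [Algebra K R] where
  g : Letter T → R
  p : V → R
  p_mul_p : ∀ u v, p u * p v = if u = v then p u else 0
  p_mul_g : ∀ x, S.Valid x → p (S.src x) * g x = g x
  g_mul_p : ∀ x, S.Valid x → g x * p (S.rng x) = g x
  sum_g_mul_g : ∀ t a c, a < S.card t → c < S.card t →
    ∑ k ∈ Finset.range (S.card (S.flip t)), g ⟨t, a, k⟩ * g ⟨S.flip t, k, c⟩ =
      if a = c then p (S.vtx t a) else 0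

variable (S K) in
/-- The regular representation on words. -/
noncomputable def reg : Rep S K (Module.End K (Word T V →₀ K)) where
  g := S.X K
  p := S.P K
  p_mul_p := P_comp_P
  p_mul_g x _ := P_comp_X x
  g_mul_p x _ := X_comp_P x
  sum_g_mul_g _ _ _ ha hc := sum_X_X ha hc

variable (S K) in
/-- The span of the normal words. -/
noncomputable abbrev normals : Submodule K (Word T V →₀ K) :=
  Finsupp.supported K K {q : Word T V | S.Normal q.1 q.2}

theorem e_mem_normals {l : List (Letter T)} {w : V} (h : S.Normal l w) :
    e K l w ∈ S.normals K :=
  Finsupp.single_mem_supported K 1 h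

/-- A linear map sends normal vectors into a submodule as soon as it does so on normal words. -/
theorem map_mem_of_normal {M : Type} [AddCommGroup M] [Module K M] (f : (Word T V →₀ K) →ₗ[K] M)
    (N : Submodule K M) (h : ∀ l w, S.Normal l w → f (e K l w) ∈ N) {B : Word T V →₀ K}
    (hB : B ∈ S.normals K) : f B ∈ N := by
  rw [normals, Finsupp.supported_eq_span_single] at hB
  refine (Submodule.span_le (p := N.comap f)).2 ?_ hB
  rintro _ ⟨⟨l, w⟩, hq, rfl⟩
  exact h l w hq

/-- Linear maps agree on normal vectors as soon as they do so on normal words. -/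
theorem map_eq_of_normal {M : Type} [AddCommMonoid M] [Module K M] (f f' : (Word T V →₀ K) →ₗ[K] M)
    (h : ∀ l w, S.Normal l w → f (e K l w) = f' (e K l w)) {B : Word T V →₀ K}
    (hB : B ∈ S.normals K) : f B = f' B := by
  rw [normals, Finsupp.supported_eq_span_single] at hB
  refine LinearMap.eqOn_span ?_ hB
  rintro _ ⟨⟨l, w⟩, hq, rfl⟩
  exact h l w hq

theorem X_mem_normals (x : Letter T) {B : Word T V →₀ K} (hB : B ∈ S.normals K) :
    S.X K x B ∈ S.normals K := by
  refine map_mem_of_normal _ _ (fun l w _ => ?_) hB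
  rcases S.X_e_cases x l w with h | h | ⟨t, a, d, l', rfl, rfl, ha, h⟩
  · rw [X_e_of_not h]; exact zero_mem _
  · rw [X_e_of_normal h]; exact e_mem_normals h
  · rw [X_e_of_bad h ha]
    refine sub_mem ?_ (sum_mem fun k hk => ?_)
    · split_ifs
      · exact e_mem_normals h.2.2.2
      · exact zero_mem _
    · rw [Finset.mem_Ico] at hk
      exact e_mem_normals (h.cons_pair ha hk.1 hk.2)

theorem P_mem_normals (u : V) {B : Word T V →₀ K} (hB : B ∈ S.normals K) :
    S.P K u B ∈ S.normals K := by
  refine map_mem_of_normal _ _ (fun l w h => ?_) hB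
  rw [P_e h]
  split_ifs
  · exact e_mem_normals h
  · exact zero_mem _

namespace Rep

variable {R : Type} [Ring R] [Algebra K R] (ρ : Rep S K R)

/-- The value of a word in an algebra. -/
def word : List (Letter T) → V → R
  | [], w => ρ.p w
  | x :: l, w => ρ.g x * word l w

/-- Linear extension of `Rep.word`. -/
noncomputable def lin : (Word T V →₀ K) →ₗ[K] R :=
  Finsupp.linearCombination K fun q => ρ.word q.1 q.2

theorem lin_e (l : List (Letter T)) (w : V) : ρ.lin (e K l w) = ρ.word l w := by
  simp [lin, e]

theorem p_mul_word {l : List (Letter T)} {w : V} (h : S.Normal l w) (u : V) :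
    ρ.p u * ρ.word l w = if S.start l w = u then ρ.word l w else 0 := by
  have key : ρ.p (S.start l w) * ρ.word l w = ρ.word l w := by
    cases l with
    | nil => simp [word, start, ρ.p_mul_p]
    | cons x l => rw [word, ← mul_assoc, start, ρ.p_mul_g x h.1]
  split_ifs with hu
  · rw [← hu, key]
  · rw [← key, ← mul_assoc, ρ.p_mul_p, if_neg (Ne.symm hu), zero_mul]

theorem lin_P {B : Word T V →₀ K} (hB : B ∈ S.normals K) (u : V) :
    ρ.lin (S.P K u B) = ρ.p u * ρ.lin B := by
  refine map_eq_of_normal (ρ.lin ∘ₗ S.P K u) (LinearMap.mulLeft K (ρ.p u) ∘ₗ ρ.lin)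
    (fun l w h => ?_) hB
  simp only [LinearMap.comp_apply, LinearMap.mulLeft_apply]
  rw [P_e h, lin_e, p_mul_word ρ h]
  split_ifs
  · rw [lin_e]
  · rw [map_zero]

theorem g_mul_word {x : Letter T} {l : List (Letter T)} {w : V} (hx : S.Valid x)
    (hl : S.Normal l w) : ρ.lin (S.X K x (e K l w)) = ρ.g x * ρ.word l w := by
  rcases S.X_e_cases x l w with h | h | ⟨t, a, d, l', rfl, rfl, ha, h⟩
  · have hne : S.start l w ≠ S.rng x := fun h' => h ⟨hx, h'.symm, hl⟩
    rw [X_e_of_not h, map_zero, ← ρ.g_mul_p x hx, mul_assoc, ρ.p_mul_word hl, if_neg hne, mul_zero]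
  · rw [X_e_of_normal h, lin_e, word]
  · have hd : d < S.card t := by simpa [S.flip_flip] using h.1.2
    have hst : S.start l' w = S.vtx t d := by
      rw [← h.2.1]
      simp [rng, S.flip_flip]
    have hrel := ρ.sum_g_mul_g t a d ha hd
    rw [sum_range_card, ← eq_sub_iff_add_eq] at hrel
    rw [X_e_of_bad h ha, map_sub, map_sum, word, ← mul_assoc, hrel, sub_mul, Finset.sum_mul]
    congr 1
    · split_ifs with had
      · rw [lin_e, ρ.p_mul_word h.2.2.2, if_pos (by rw [hst, had])]
      · rw [map_zero, zero_mul]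
    · refine Finset.sum_congr rfl fun k _ => ?_
      rw [lin_e, word, word, mul_assoc]

theorem lin_X {x : Letter T} (hx : S.Valid x) {B : Word T V →₀ K} (hB : B ∈ S.normals K) :
    ρ.lin (S.X K x B) = ρ.g x * ρ.lin B := by
  refine map_eq_of_normal (ρ.lin ∘ₗ S.X K x) (LinearMap.mulLeft K (ρ.g x) ∘ₗ ρ.lin)
    (fun l w h => ?_) hB
  simp only [LinearMap.comp_apply, LinearMap.mulLeft_apply]
  rw [ρ.g_mul_word hx h, lin_e]

theorem word_concat {l : List (Letter T)} {x : Letter T} {u : V} (h : S.Normal (l ++ [x]) u) :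
    ρ.word (l ++ [x]) u = ρ.word l (S.src x) * ρ.g x := by
  induction l with
  | nil =>
    have h1 : S.rng x = u := h.2.1
    rw [List.nil_append, word, word, word, ρ.p_mul_g x h.1, ← h1, ρ.g_mul_p x h.1]
  | cons y l ih =>
    rw [List.cons_append, word, ih h.2.2.2, word, mul_assoc]

end Rep

theorem reg_word_e_of_ne {l l' : List (Letter T)} {u w : V} (h : u ≠ S.start l' w) :
    (S.reg K).word l u (e K l' w) = 0 := by
  induction l with
  | nil =>
    change S.P K u (e K l' w) = 0
    by_cases hn : S.Normal l' w
    · rw [P_e hn, if_neg h.symm]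
    · exact P_e_of_not_normal hn u
  | cons x l ih =>
    change S.X K x ((S.reg K).word l u (e K l' w)) = 0
    rw [ih, map_zero]

theorem reg_word_e_of_normal {l l' : List (Letter T)} {u w : V} (h : S.Normal (l ++ l') w)
    (hu : u = S.start l' w) : (S.reg K).word l u (e K l' w) = e K (l ++ l') w := by
  induction l with
  | nil =>
    change S.P K u (e K l' w) = e K l' w
    rw [P_e (l := l') h, if_pos hu.symm]
  | cons x l ih =>
    change S.X K x ((S.reg K).word l u (e K l' w)) = e K (x :: (l ++ l')) w
    rw [ih h.2.2.2, X_e_of_normal (l := l ++ l') h]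

variable (T V K) in
/-- The span of the words of length at most `N`. -/
noncomputable abbrev lengthLE (N : ℕ) : Submodule K (Word T V →₀ K) :=
  Finsupp.supported K K {q : Word T V | q.1.length ≤ N}

theorem map_mem_of_lengthLE {N : ℕ} (f : Module.End K (Word T V →₀ K))
    (L : Submodule K (Word T V →₀ K)) (h : ∀ l w, l.length ≤ N → f (e K l w) ∈ L)
    {B : Word T V →₀ K} (hB : B ∈ lengthLE T V K N) : f B ∈ L := by
  rw [lengthLE, Finsupp.supported_eq_span_single] at hB
  refine (Submodule.span_le (p := L.comap f)).2 ?_ hB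
  rintro _ ⟨⟨l, w⟩, hq, rfl⟩
  exact h l w hq

theorem e_mem_lengthLE {l : List (Letter T)} {w : V} {N : ℕ} (h : l.length ≤ N) :
    e K l w ∈ lengthLE T V K N :=
  Finsupp.single_mem_supported K 1 h

theorem X_mem_lengthLE (x : Letter T) {N : ℕ} {B : Word T V →₀ K} (hB : B ∈ lengthLE T V K N) :
    S.X K x B ∈ lengthLE T V K (N + 1) := by
  refine map_mem_of_lengthLE _ _ (fun l w hN => ?_) hB
  rcases S.X_e_cases x l w with h | h | ⟨t, a, d, l', rfl, rfl, ha, h⟩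
  · rw [X_e_of_not h]; exact zero_mem _
  · rw [X_e_of_normal h]; exact e_mem_lengthLE (by simpa using hN)
  · rw [X_e_of_bad h ha]
    rw [List.length_cons] at hN
    refine sub_mem ?_ (sum_mem fun k _ => e_mem_lengthLE (by simpa using hN))
    split_ifs
    · exact e_mem_lengthLE (by omega)
    · exact zero_mem _

theorem reg_word_mem_lengthLE (l l' : List (Letter T)) (u w : V) :
    (S.reg K).word l u (e K l' w) ∈ lengthLE T V K (l.length + l'.length) := by
  induction l with
  | nil =>
    change S.P K u (e K l' w) ∈ _
    by_cases hn : S.Normal l' w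
    · rw [P_e hn]
      split_ifs
      · exact e_mem_lengthLE (by simp)
      · exact zero_mem _
    · rw [P_e_of_not_normal hn]; exact zero_mem _
  | cons x l ih =>
    rw [List.length_cons, add_right_comm]
    exact X_mem_lengthLE x ih

theorem reg_word_e_apply_of_lt {l l' l'' : List (Letter T)} {u w w' : V}
    (h : l.length + l'.length < l''.length) : (S.reg K).word l u (e K l' w) (l'', w') = 0 := by
  have := (Finsupp.mem_supported' K _).1 (S.reg_word_mem_lengthLE (K := K) l l' u w) (l'', w')
  exact this (by simpa using h)

/-- The product of two words with a forbidden junction. -/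
theorem reg_word_e_of_bad {l l' : List (Letter T)} {t : T} {a d : ℕ} {u w : V}
    (h : S.Normal (l ++ [⟨t, a, 0⟩]) u) (h' : S.Normal (⟨S.flip t, 0, d⟩ :: l') w) :
    (S.reg K).word (l ++ [⟨t, a, 0⟩]) u (e K (⟨S.flip t, 0, d⟩ :: l') w) =
      (if a = d then (S.reg K).word l (S.vtx t a) (e K l' w) else 0) -
        ∑ k ∈ Finset.Ico 1 (S.card (S.flip t)),
          e K (l ++ ⟨t, a, k⟩ :: ⟨S.flip t, k, d⟩ :: l') w := by
  have ha : a < S.card t := h.of_append_right.1.1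
  rw [(S.reg K).word_concat h]
  change (S.reg K).word l (S.vtx t a) (S.X K ⟨t, a, 0⟩ _) = _
  rw [X_e_of_bad h' ha, map_sub, map_sum, apply_ite ((S.reg K).word l (S.vtx t a)), map_zero]
  congr 1
  refine Finset.sum_congr rfl fun k hk => ?_
  rw [Finset.mem_Ico] at hk
  exact reg_word_e_of_normal (h.append_replace (h'.cons_pair ha hk.1 hk.2) rfl rfl) rfl

/-- Two words are matched if the last letter of the first and the first letter of the second are
`h_{ak}` and `h*_{kd}`. -/
def Matched (S : Sys T V) (l l' : List (Letter T)) : Prop :=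
  ∃ l₀ t a k d l₁, l = l₀ ++ [⟨t, a, k⟩] ∧ l' = ⟨S.flip t, k, d⟩ :: l₁

/-- The words of top length in a product of two normal words. -/
theorem eq_of_reg_word_e_apply_ne_zero {l l' l'' : List (Letter T)} {u w w' : V}
    (hl : S.Normal l u) (hl' : S.Normal l' w) (hle : l.length + l'.length ≤ l''.length)
    (h : (S.reg K).word l u (e K l' w) (l'', w') ≠ 0) :
    w' = w ∧ u = S.start l' w ∧ (l'' = l ++ l' ∨ ∃ l₀ t a k d l₁, 1 ≤ k ∧
      l = l₀ ++ [⟨t, a, 0⟩] ∧ l' = ⟨S.flip t, 0, d⟩ :: l₁ ∧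
        l'' = l₀ ++ ⟨t, a, k⟩ :: ⟨S.flip t, k, d⟩ :: l₁) := by
  have hu : u = S.start l' w := by
    by_contra hu
    rw [reg_word_e_of_ne hu] at h
    exact h rfl
  by_cases hb : ∃ l₀ x y l₁, l = l₀ ++ [x] ∧ l' = y :: l₁ ∧ S.Bad x y
  · obtain ⟨l₀, ⟨t, a, b⟩, ⟨t', c, d⟩, l₁, rfl, rfl, h1, h2, h3⟩ := hb
    simp only at h1 h2 h3
    subst h1 h2 h3
    rw [reg_word_e_of_bad hl hl', Finsupp.sub_apply] at h
    have h0 : (if a = d then (S.reg K).word l₀ (S.vtx t a) (e K l₁ w) else 0) (l'', w') = 0 := by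
      split_ifs
      · refine reg_word_e_apply_of_lt ?_
        simp only [List.length_append, List.length_cons, List.length_nil] at hle
        omega
      · rfl
    rw [h0, zero_sub, neg_ne_zero, Finsupp.finsetSum_apply] at h
    obtain ⟨k, hk, hne⟩ := Finset.exists_ne_zero_of_sum_ne_zero h
    rw [e, Finsupp.single_apply_ne_zero] at hne
    obtain ⟨rfl, rfl⟩ := Prod.mk.inj hne.1
    exact ⟨rfl, hu, .inr ⟨l₀, t, a, k, d, l₁, (Finset.mem_Ico.1 hk).1, rfl, rfl, rfl⟩⟩
  · have hn : S.Normal (l ++ l') w := hl.append hl' hu fun l₀ x y l₁ h1 h2 h3 =>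
      hb ⟨l₀, x, y, l₁, h1, h2, h3⟩
    rw [reg_word_e_of_normal hn hu, e, Finsupp.single_apply_ne_zero] at h
    obtain ⟨rfl, rfl⟩ := Prod.mk.inj h.1
    exact ⟨rfl, hu, .inl rfl⟩

theorem reg_lin_apply (A B : Word T V →₀ K) (z : Word T V) :
    (S.reg K).lin A B z = ∑ p ∈ A.support, ∑ q ∈ B.support,
      A p * (B q * (S.reg K).word p.1 p.2 (e K q.1 q.2) z) := by
  have hB : B = ∑ q ∈ B.support, B q • e K q.1 q.2 := by
    conv_lhs => rw [← B.sum_single]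
    exact Finset.sum_congr rfl fun q _ => by simp [e]
  rw [Rep.lin, Finsupp.linearCombination_apply, Finsupp.sum, LinearMap.sum_apply,
    Finsupp.finsetSum_apply]
  refine Finset.sum_congr rfl fun p _ => ?_
  rw [LinearMap.smul_apply, Finsupp.smul_apply, smul_eq_mul, ← Finset.mul_sum]
  congr 1
  conv_lhs => rw [hB]
  rw [map_sum, Finsupp.finsetSum_apply]
  exact Finset.sum_congr rfl fun q _ => by rw [map_smul, Finsupp.smul_apply, smul_eq_mul]

/-- The local domain property of the regular representation. -/
theorem reg_lin_ne_zero {A B : Word T V →₀ K} {u : V} (hA : A ∈ S.normals K)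
    (hB : B ∈ S.normals K) (hBu : ∀ q ∈ B.support, S.start q.1 q.2 = u)
    (hAu : ∃ p ∈ A.support, p.2 = u) (hB0 : B ≠ 0) : (S.reg K).lin A B ≠ 0 := by
  obtain ⟨⟨l, u'⟩, hp, hpm⟩ := (A.support.filter (·.2 = u)).exists_max_image
    (fun p => p.1.length) (hAu.imp fun p hp => Finset.mem_filter.2 hp)
  obtain ⟨hp, hu' : u' = u⟩ := Finset.mem_filter.1 hp
  subst u'
  obtain ⟨⟨l', w⟩, hq, hqm⟩ := B.support.exists_max_image (fun q => q.1.length)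
    (Finsupp.support_nonempty_iff.2 hB0)
  have hAm : ∀ m, (m, u) ∈ A.support → m.length ≤ l.length := fun m hm =>
    hpm (m, u) (Finset.mem_filter.2 ⟨hm, rfl⟩)
  have hBm : ∀ m' w', (m', w') ∈ B.support → m'.length ≤ l'.length := fun m' w' hm =>
    hqm (m', w') hm
  have hAn : ∀ m v, (m, v) ∈ A.support → S.Normal m v := fun m v hm => hA hm
  have hBn : ∀ m v, (m, v) ∈ B.support → S.Normal m v := fun m v hm => hB hm
  have hBst : ∀ m v, (m, v) ∈ B.support → u = S.start m v := fun m v hm => (hBu _ hm).symm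
  suffices key : ∃ m m' l'' w, (m, u) ∈ A.support ∧ (m', w) ∈ B.support ∧
      l''.length = l.length + l'.length ∧ (S.reg K).word m u (e K m' w) (l'', w) ≠ 0 ∧
        ∀ n n', (n, u) ∈ A.support → (n', w) ∈ B.support →
          (S.reg K).word n u (e K n' w) (l'', w) ≠ 0 → n = m ∧ n' = m' by
    obtain ⟨m, m', l'', w, hm, hm', hlen, hne, huniq⟩ := key
    have huniq' : ∀ p ∈ A.support, ∀ q ∈ B.support,
        (S.reg K).word p.1 p.2 (e K q.1 q.2) (l'', w) ≠ 0 → p = (m, u) ∧ q = (m', w) := by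
      rintro ⟨n, v⟩ hn ⟨n', v'⟩ hn' h
      obtain rfl : v = u := by
        by_contra hv
        refine h ?_
        rw [reg_word_e_of_ne (by rwa [← hBst _ _ hn'])]
        rfl
      have hle : n.length + n'.length ≤ l''.length := by
        rw [hlen]
        exact add_le_add (hAm _ hn) (hBm _ _ hn')
      obtain ⟨rfl, -, -⟩ := eq_of_reg_word_e_apply_ne_zero (hAn _ _ hn) (hBn _ _ hn') hle h
      obtain ⟨rfl, rfl⟩ := huniq n n' hn hn' h
      exact ⟨rfl, rfl⟩
    intro h0
    have hz := reg_lin_apply (S := S) A B (l'', w)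
    rw [h0, Finset.sum_eq_single (m, u), Finset.sum_eq_single (m', w)] at hz
    · exact mul_ne_zero (Finsupp.mem_support_iff.1 hm)
        (mul_ne_zero (Finsupp.mem_support_iff.1 hm') hne) hz.symm
    · intro q hq hqne
      by_contra h
      exact hqne (huniq' _ hm q hq (right_ne_zero_of_mul (right_ne_zero_of_mul h))).2
    · exact fun h => absurd hm' h
    · intro p hp hpne
      refine Finset.sum_eq_zero fun q hq => ?_
      by_contra h
      exact hpne (huniq' p hp q hq (right_ne_zero_of_mul (right_ne_zero_of_mul h))).1
    · exact fun h => absurd hm h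
  by_cases hmatch : ∃ m m' w, (m, u) ∈ A.support ∧ m.length = l.length ∧ (m', w) ∈ B.support ∧
      m'.length = l'.length ∧ ¬ S.Matched m m'
  · obtain ⟨m, m', w, hm, hml, hm', hml', hmm⟩ := hmatch
    refine ⟨m, m', m ++ m', w, hm, hm', by simp [hml, hml'], ?_, fun n n' hn hn' h => ?_⟩
    · rw [reg_word_e_of_normal _ (hBst _ _ hm'), e, Finsupp.single_eq_same]
      · exact one_ne_zero
      · refine (hAn _ _ hm).append (hBn _ _ hm') (hBst _ _ hm') ?_
        rintro l₀ ⟨t, a, b⟩ ⟨t', c, d⟩ l₁ rfl rfl ⟨h1, h2, h3⟩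
        simp only at h1 h2 h3
        subst h1 h2 h3
        exact hmm ⟨l₀, t, a, 0, d, l₁, rfl, rfl⟩
    · have h1 := hAm _ hn
      have h2 := hBm _ _ hn'
      obtain ⟨-, -, heq | ⟨l₀, t, a, k, d, l₁, hk, rfl, rfl, heq⟩⟩ :=
        eq_of_reg_word_e_apply_ne_zero (hAn _ _ hn) (hBn _ _ hn')
          (by rw [List.length_append]; omega) h
      · have h3 := congrArg List.length heq
        simp only [List.length_append] at h3
        obtain ⟨rfl, rfl⟩ := List.append_inj heq (by omega)
        exact ⟨rfl, rfl⟩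
      · have h3 := congrArg List.length heq
        simp only [List.length_append, List.length_cons, List.length_nil] at h1 h2 h3
        rw [List.append_cons l₀] at heq
        obtain ⟨rfl, rfl⟩ := List.append_inj heq
          (by simp only [List.length_append, List.length_cons, List.length_nil]; omega)
        exact absurd ⟨l₀, t, a, k, d, l₁, rfl, rfl⟩ hmm
  · push Not at hmatch
    obtain ⟨l₀, t, a, k, d, l₁, rfl, rfl⟩ := hmatch l l' w hp rfl hq rfl
    have hlast : ∀ m, (m, u) ∈ A.support → m.length = (l₀ ++ [Letter.mk t a k]).length →
        ∀ m₀ t' a' k', m = m₀ ++ [⟨t', a', k'⟩] → k' = k := by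
      rintro m hm hml m₀ t' a' k' rfl
      obtain ⟨l₂, t₂, a₂, k₂, d₂, l₃, h1, h2⟩ := hmatch _ _ w hm hml hq rfl
      have h3 := List.append_inj' h1 rfl
      simp only [List.cons.injEq, Letter.mk.injEq] at h2 h3
      omega
    have hst := hBst _ _ hq
    have hNl := hAn _ _ hp
    have hNl' := hBn _ _ hq
    by_cases hk0 : k = 0
    · subst hk0
      have hcard := S.two_le (S.flip t)
      refine ⟨_, _, l₀ ++ ⟨t, a, 1⟩ :: ⟨S.flip t, 1, d⟩ :: l₁, w, hp, hq, by simp; omega, ?_,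
        fun n n' hn hn' h => ?_⟩
      · rw [reg_word_e_of_bad hNl hNl', Finsupp.sub_apply, Finsupp.finsetSum_apply,
          Finset.sum_eq_single 1]
        · rw [e, Finsupp.single_eq_same]
          have h0 : (if a = d then (S.reg K).word l₀ (S.vtx t a) (e K l₁ w) else 0)
              (l₀ ++ ⟨t, a, 1⟩ :: ⟨S.flip t, 1, d⟩ :: l₁, w) = 0 := by
            split_ifs
            · exact reg_word_e_apply_of_lt (by simp)
            · rfl
          rw [h0]
          simp
        · intro k _ hk
          rw [e, Finsupp.single_apply, if_neg]
          intro h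
          simp [hk] at h
        · intro h
          exact absurd (Finset.mem_Ico.2 ⟨le_rfl, by omega⟩) h
      · have h1 := hAm _ hn
        have h2 := hBm _ _ hn'
        obtain ⟨-, -, heq | ⟨l₂, t₂, a₂, k₂, d₂, l₃, hk₂, rfl, rfl, heq⟩⟩ :=
          eq_of_reg_word_e_apply_ne_zero (hAn _ _ hn) (hBn _ _ hn')
            (by simp at h1 h2 ⊢; omega) h
        · have h3 := congrArg List.length heq
          simp only [List.length_append, List.length_cons, List.length_nil] at h1 h2 h3
          rw [List.append_cons l₀] at heq
          obtain ⟨rfl, rfl⟩ := List.append_inj heq (by simp; omega)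
          exact absurd (hlast _ hn (by simp) l₀ t a 1 rfl) (by omega)
        · have h3 := congrArg List.length heq
          simp only [List.length_append, List.length_cons, List.length_nil] at h1 h2 h3
          obtain ⟨rfl, h4⟩ := List.append_inj heq (by omega)
          simp only [List.cons.injEq, Letter.mk.injEq] at h4
          obtain ⟨⟨rfl, rfl, rfl⟩, ⟨-, -, rfl⟩, rfl⟩ := h4
          exact ⟨rfl, rfl⟩
    · refine ⟨_, _, (l₀ ++ [⟨t, a, k⟩]) ++ ⟨S.flip t, k, d⟩ :: l₁, w, hp, hq,
        List.length_append, ?_,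
        fun n n' hn hn' h => ?_⟩
      · rw [reg_word_e_of_normal _ hst, e, Finsupp.single_eq_same]
        · exact one_ne_zero
        · refine hNl.append hNl' hst fun l₂ x y l₃ h1 h2 h3 => hk0 ?_
          have h4 := List.append_inj' h1 rfl
          simp only [List.cons.injEq, and_true] at h4
          rw [← h3.2.1, ← h4.2]
      · have h1 := hAm _ hn
        have h2 := hBm _ _ hn'
        obtain ⟨-, -, heq | ⟨l₂, t₂, a₂, k₂, d₂, l₃, hk₂, rfl, rfl, heq⟩⟩ :=
          eq_of_reg_word_e_apply_ne_zero (hAn _ _ hn) (hBn _ _ hn')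
            (by simp at h1 h2 ⊢; omega) h
        · have h3 := congrArg List.length heq
          simp only [List.length_append, List.length_cons, List.length_nil] at h1 h2 h3
          obtain ⟨rfl, rfl⟩ := List.append_inj heq (by simp; omega)
          exact ⟨rfl, rfl⟩
        · have h3 := congrArg List.length heq
          simp only [List.length_append, List.length_cons, List.length_nil] at h1 h2 h3
          exact absurd (hlast _ hn (by simp; omega) l₂ t₂ a₂ 0 rfl) (Ne.symm hk0)

namespace Rep

variable {R : Type} [Ring R] [Algebra K R] (ρ : Rep S K R)

theorem map_lin (φ : R →ₐ[K] Module.End K (Word T V →₀ K)) (hg : ∀ x, S.Valid x →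
    φ (ρ.g x) = S.X K x) (hp : ∀ u, φ (ρ.p u) = S.P K u) {A : Word T V →₀ K}
    (hA : A ∈ S.normals K) : φ (ρ.lin A) = (S.reg K).lin A := by
  refine map_eq_of_normal (φ.toLinearMap ∘ₗ ρ.lin) (S.reg K).lin (fun l w h => ?_) hA
  simp only [LinearMap.comp_apply, AlgHom.toLinearMap_apply, lin_e]
  induction l with
  | nil => exact hp w
  | cons x l ih => rw [word, word, map_mul, hg x h.1, ih h.2.2.2]; rfl

end Rep

/-- The normal words are linearly independent in the regular representation. -/
theorem reg_lin_ne_zero_of_ne_zero {A : Word T V →₀ K} (hA : A ∈ S.normals K) (hA0 : A ≠ 0) :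
    (S.reg K).lin A ≠ 0 := by
  obtain ⟨⟨l, u⟩, hp⟩ := Finsupp.support_nonempty_iff.2 hA0
  have h := reg_lin_ne_zero (B := e K [] u) hA (e_mem_normals trivial) ?_ ⟨_, hp, rfl⟩ ?_
  · intro h'
    rw [h', LinearMap.zero_apply] at h
    exact h rfl
  · intro q hq
    rw [Finsupp.mem_support_iff, e, Finsupp.single_apply_ne_zero] at hq
    rw [hq.1]
    rfl
  · exact Finsupp.single_ne_zero.2 one_ne_zero

theorem start_eq_of_mem_support_P {u : V} {B : Word T V →₀ K} :
    ∀ q ∈ (S.P K u B).support, S.start q.1 q.2 = u := by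
  have : S.P K u B ∈ Finsupp.supported K K {q : Word T V | S.start q.1 q.2 = u} := by
    rw [P, Finsupp.linearCombination_apply]
    refine sum_mem fun q _ => Submodule.smul_mem _ _ ?_
    split_ifs with h
    · exact Finsupp.single_mem_supported K 1 h.2
    · exact zero_mem _
  exact fun q hq => this hq

theorem X_apply_ne_zero {x : Letter T} (hx : S.Valid x) {B : Word T V →₀ K}
    (hB : B ∈ S.normals K) (hBu : ∀ q ∈ B.support, S.start q.1 q.2 = S.rng x) (hB0 : B ≠ 0) :
    S.X K x B ≠ 0 := by
  have hn : S.Normal [x] (S.rng x) := ⟨hx, rfl, by simp, trivial⟩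
  have h := reg_lin_ne_zero (A := e K [x] (S.rng x)) (e_mem_normals hn) hB hBu
    ⟨([x], S.rng x), by simp [e], rfl⟩ hB0
  rw [Rep.lin_e] at h
  change (S.X K x * S.P K (S.rng x)) B ≠ 0 at h
  rwa [X_comp_P] at h

theorem P_start_ne_zero {B : Word T V →₀ K} (hB : B ∈ S.normals K) {q : Word T V}
    (hq : q ∈ B.support) : S.P K (S.start q.1 q.2) B ≠ 0 := by
  have hf : ∀ r : Word T V, S.Normal r.1 r.2 → ∀ z : Word T V, S.start z.1 z.2 = S.start q.1 q.2 →
      S.P K (S.start q.1 q.2) (e K r.1 r.2) z = e K r.1 r.2 z := by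
    intro r hr z hz
    rw [P_e hr]
    split_ifs with h
    · rfl
    · rw [e, Finsupp.single_apply, if_neg]
      · rfl
      · rintro rfl
        exact h hz
  have key := map_eq_of_normal (Finsupp.lapply q ∘ₗ S.P K (S.start q.1 q.2))
    (Finsupp.lapply (R := K) q) (fun l w h => hf (l, w) h q rfl) hB
  intro h0
  rw [LinearMap.comp_apply, h0, map_zero] at key
  exact Finsupp.mem_support_iff.1 hq key.symm

end Sys

end HalfEdge

namespace HLPA

open HalfEdge

variable (K : Type) [Field K] {H0 H1 : Type} (s r : H1 → List H0)

/-- The sources of an oriented hyperedge. -/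
def side : H1 × Bool → List H0
  | (h, true) => s h
  | (h, false) => r h

/-- The element of the algebra given by a letter. -/
noncomputable def letter : Letter (H1 × Bool) → Ambient K H0 H1 s r
  | ⟨(h, true), i, j⟩ =>
    if hij : i < (s h).length ∧ j < (r h).length then
      amb K H0 H1 s r (.edge h ⟨i, hij.1⟩ ⟨j, hij.2⟩) else 0
  | ⟨(h, false), j, i⟩ =>
    if hij : i < (s h).length ∧ j < (r h).length then
      amb K H0 H1 s r (.ghost h ⟨i, hij.1⟩ ⟨j, hij.2⟩) else 0

variable {K s r}

theorem mk_rel {x y : FreeAlgebra K (HGen H0 H1 s r)} (h : Rel K H0 H1 s r x y) :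
    RingQuot.mkAlgHom K (Rel K H0 H1 s r) x = RingQuot.mkAlgHom K (Rel K H0 H1 s r) y :=
  RingQuot.mkAlgHom_rel K h

theorem letter_edge {h : H1} (i : Fin (s h).length) (j : Fin (r h).length) :
    letter K s r ⟨(h, true), i, j⟩ = amb K H0 H1 s r (.edge h i j) :=
  dif_pos ⟨i.2, j.2⟩

theorem letter_ghost {h : H1} (i : Fin (s h).length) (j : Fin (r h).length) :
    letter K s r ⟨(h, false), j, i⟩ = amb K H0 H1 s r (.ghost h i j) :=
  dif_pos ⟨i.2, j.2⟩

theorem amb_mem (x : HGen H0 H1 s r) : amb K H0 H1 s r x ∈ LPAsub K H0 H1 s r :=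
  NonUnitalAlgebra.subset_adjoin K (Set.mem_range_self x)

variable [Nonempty H0]

variable (s r) in
/-- The oriented hyperedges of a hypergraph satisfying Condition (LV). -/
noncomputable def sys (hLV : ∀ h : H1, 2 ≤ (s h).length ∧ 2 ≤ (r h).length) :
    Sys (H1 × Bool) H0 where
  flip t := (t.1, !t.2)
  flip_flip t := by simp
  card t := (side s r t).length
  two_le := by
    rintro ⟨h, _ | _⟩
    · exact (hLV h).2
    · exact (hLV h).1
  vtx t a := (side s r t).getD a (Classical.arbitrary H0)

variable (hLV : ∀ h : H1, 2 ≤ (s h).length ∧ 2 ≤ (r h).length)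

theorem vtx_source {h : H1} (i : Fin (s h).length) : (sys s r hLV).vtx (h, true) i = (s h).get i :=
  List.getD_eq_getElem _ _ i.2

theorem vtx_range {h : H1} (j : Fin (r h).length) : (sys s r hLV).vtx (h, false) j = (r h).get j :=
  List.getD_eq_getElem _ _ j.2

/-- A property of all valid letters may be checked on edges and ghost edges. -/
theorem valid_cases {motive : Letter (H1 × Bool) → Prop}
    (edge : ∀ h (i : Fin (s h).length) (j : Fin (r h).length), motive ⟨(h, true), i, j⟩)
    (ghost : ∀ h (i : Fin (s h).length) (j : Fin (r h).length), motive ⟨(h, false), j, i⟩)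
    (x : Letter (H1 × Bool)) (hx : (sys s r hLV).Valid x) : motive x := by
  obtain ⟨⟨h, _ | _⟩, a, b⟩ := x
  · exact ghost h ⟨b, hx.2⟩ ⟨a, hx.1⟩
  · exact edge h ⟨a, hx.1⟩ ⟨b, hx.2⟩

variable (K) in
/-- The generators of the Leavitt path algebra satisfy its relations. -/
noncomputable def rep : (sys s r hLV).Rep K (Ambient K H0 H1 s r) where
  g := letter K s r
  p v := amb K H0 H1 s r (.vertex v)
  p_mul_p u v := by
    have := mk_rel (Rel.vtx (K := K) (s := s) (r := r) u v)
    rwa [map_mul, apply_ite (RingQuot.mkAlgHom K (Rel K H0 H1 s r)), map_zero] at this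
  p_mul_g := by
    refine valid_cases hLV (fun h i j => ?_) fun h i j => ?_
    · rw [letter_edge, Sys.src, vtx_source]
      exact (map_mul _ _ _).symm.trans (mk_rel (Rel.src_edge (K := K) (s := s) (r := r) h i j))
    · rw [letter_ghost, Sys.src, vtx_range]
      exact (map_mul _ _ _).symm.trans (mk_rel (Rel.rng_ghost (K := K) (s := s) (r := r) h i j))
  g_mul_p := by
    refine valid_cases hLV (fun h i j => ?_) fun h i j => ?_
    · have : (sys s r hLV).rng ⟨(h, true), i, j⟩ = (r h).get j := vtx_range hLV j
      rw [letter_edge, this]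
      exact (map_mul _ _ _).symm.trans (mk_rel (Rel.edge_rng (K := K) (s := s) (r := r) h i j))
    · have : (sys s r hLV).rng ⟨(h, false), j, i⟩ = (s h).get i := vtx_source hLV i
      rw [letter_ghost, this]
      exact (map_mul _ _ _).symm.trans (mk_rel (Rel.ghost_src (K := K) (s := s) (r := r) h i j))
  sum_g_mul_g := by
    rintro ⟨h, _ | _⟩ a c ha hc
    · have := mk_rel (Rel.cuntz2 (K := K) (s := s) (r := r) h ⟨a, ha⟩ ⟨c, hc⟩)
      rw [map_sum, apply_ite (RingQuot.mkAlgHom K (Rel K H0 H1 s r)), map_zero] at this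
      simp only [map_mul, Fin.ext_iff] at this
      rw [← vtx_range hLV] at this
      refine Eq.trans ?_ this
      rw [Finset.sum_range]
      refine Finset.sum_congr rfl fun k _ => ?_
      exact congrArg₂ (· * ·) (letter_ghost (s := s) (r := r) k ⟨a, ha⟩)
        (letter_edge (s := s) (r := r) k ⟨c, hc⟩)
    · have := mk_rel (Rel.cuntz1 (K := K) (s := s) (r := r) h ⟨a, ha⟩ ⟨c, hc⟩)
      rw [map_sum, apply_ite (RingQuot.mkAlgHom K (Rel K H0 H1 s r)), map_zero] at this
      simp only [map_mul, Fin.ext_iff] at this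
      rw [← vtx_source hLV] at this
      refine Eq.trans ?_ this
      rw [Finset.sum_range]
      refine Finset.sum_congr rfl fun k _ => ?_
      exact congrArg₂ (· * ·) (letter_edge (s := s) (r := r) ⟨a, ha⟩ k)
        (letter_ghost (s := s) (r := r) ⟨c, hc⟩ k)

variable (K) in
/-- The operators by which the generators act on words. -/
noncomputable def opGen : HGen H0 H1 s r → Module.End K (Word (H1 × Bool) H0 →₀ K)
  | .vertex v => (sys s r hLV).P K v
  | .edge h i j => (sys s r hLV).X K ⟨(h, true), i, j⟩
  | .ghost h i j => (sys s r hLV).X K ⟨(h, false), j, i⟩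

theorem lift_opGen_rel {x y : FreeAlgebra K (HGen H0 H1 s r)} (h : Rel K H0 H1 s r x y) :
    FreeAlgebra.lift K (opGen K hLV) x = FreeAlgebra.lift K (opGen K hLV) y := by
  cases h with
  | vtx u v =>
    rw [apply_ite (FreeAlgebra.lift K (opGen K hLV)), map_mul, map_zero]
    simp only [FreeAlgebra.lift_ι_apply]
    exact Sys.P_comp_P u v
  | src_edge h i j =>
    rw [map_mul]
    simp only [FreeAlgebra.lift_ι_apply, opGen]
    rw [← vtx_source hLV]
    exact Sys.P_comp_X (S := sys s r hLV) ⟨(h, true), i, j⟩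
  | edge_rng h i j =>
    rw [map_mul]
    simp only [FreeAlgebra.lift_ι_apply, opGen]
    rw [← vtx_range hLV]
    exact Sys.X_comp_P (S := sys s r hLV) ⟨(h, true), i, j⟩
  | rng_ghost h i j =>
    rw [map_mul]
    simp only [FreeAlgebra.lift_ι_apply, opGen]
    rw [← vtx_range hLV]
    exact Sys.P_comp_X (S := sys s r hLV) ⟨(h, false), j, i⟩
  | ghost_src h i j =>
    rw [map_mul]
    simp only [FreeAlgebra.lift_ι_apply, opGen]
    rw [← vtx_source hLV]
    exact Sys.X_comp_P (S := sys s r hLV) ⟨(h, false), j, i⟩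
  | cuntz1 h i i' =>
    rw [apply_ite (FreeAlgebra.lift K (opGen K hLV)), map_sum, map_zero]
    simp only [map_mul, FreeAlgebra.lift_ι_apply, opGen, Fin.ext_iff]
    rw [← vtx_source hLV]
    have := Sys.sum_X_X (S := sys s r hLV) (K := K) (t := (h, true)) (a := i) (c := i') i.2 i'.2
    rw [Finset.sum_range] at this
    exact this
  | cuntz2 h j j' =>
    rw [apply_ite (FreeAlgebra.lift K (opGen K hLV)), map_sum, map_zero]
    simp only [map_mul, FreeAlgebra.lift_ι_apply, opGen, Fin.ext_iff]
    rw [← vtx_range hLV]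
    have := Sys.sum_X_X (S := sys s r hLV) (K := K) (t := (h, false)) (a := j) (c := j') j.2 j'.2
    rw [Finset.sum_range] at this
    exact this

variable (K) in
/-- The action of the ambient algebra on words. -/
noncomputable def op : Ambient K H0 H1 s r →ₐ[K] Module.End K (Word (H1 × Bool) H0 →₀ K) :=
  RingQuot.liftAlgHom K ⟨FreeAlgebra.lift K (opGen K hLV), fun _ _ => lift_opGen_rel hLV⟩

theorem op_amb (x : HGen H0 H1 s r) : op K hLV (amb K H0 H1 s r x) = opGen K hLV x := by
  simp [op, amb]

theorem op_p (v : H0) : op K hLV ((rep K hLV).p v) = (sys s r hLV).P K v :=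
  op_amb hLV (.vertex v)

theorem op_g (x : Letter (H1 × Bool)) (hx : (sys s r hLV).Valid x) :
    op K hLV ((rep K hLV).g x) = (sys s r hLV).X K x := by
  refine valid_cases hLV (motive := fun x => op K hLV (letter K s r x) = (sys s r hLV).X K x)
    (fun h i j => ?_) (fun h i j => ?_) x hx
  · rw [letter_edge, op_amb, opGen]
  · rw [letter_ghost, op_amb, opGen]

theorem op_lin {A : Word (H1 × Bool) H0 →₀ K} (hA : A ∈ (sys s r hLV).normals K) :
    op K hLV ((rep K hLV).lin A) = ((sys s r hLV).reg K).lin A :=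
  (rep K hLV).map_lin _ (op_g hLV) (op_p hLV) hA

theorem lin_ne_zero {A : Word (H1 × Bool) H0 →₀ K} (hA : A ∈ (sys s r hLV).normals K)
    (hA0 : A ≠ 0) : (rep K hLV).lin A ≠ 0 := fun h =>
  Sys.reg_lin_ne_zero_of_ne_zero hA hA0 (by rw [← op_lin hLV hA, h, map_zero])

/-- Edges and ghost edges are given by valid letters. -/
theorem exists_letter {x : HGen H0 H1 s r} (hx : ¬ IsVertexLetter x) :
    ∃ y, (sys s r hLV).Valid y ∧ (sys s r hLV).src y = letterSrc x ∧
      (sys s r hLV).rng y = letterRng x ∧ (rep K hLV).g y = amb K H0 H1 s r x := by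
  cases x with
  | vertex v => exact absurd trivial hx
  | edge h i j =>
    exact ⟨⟨(h, true), i, j⟩, ⟨i.2, j.2⟩, vtx_source hLV i, vtx_range hLV j, letter_edge i j⟩
  | ghost h i j =>
    exact ⟨⟨(h, false), j, i⟩, ⟨j.2, i.2⟩, vtx_range hLV j, vtx_source hLV i, letter_ghost i j⟩

/-- The algebra acts on normal vectors, compatibly with left multiplication. -/
theorem op_mem_and_lin_op {a : Ambient K H0 H1 s r} (ha : a ∈ LPAsub K H0 H1 s r) :
    ∀ B ∈ (sys s r hLV).normals K, op K hLV a B ∈ (sys s r hLV).normals K ∧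
      (rep K hLV).lin (op K hLV a B) = a * (rep K hLV).lin B := by
  induction ha using NonUnitalAlgebra.adjoin_induction with
  | mem a ha =>
    obtain ⟨x, rfl⟩ := ha
    intro B hB
    by_cases hx : IsVertexLetter x
    · cases x with
      | vertex v =>
        rw [op_amb]
        exact ⟨Sys.P_mem_normals v hB, (rep K hLV).lin_P hB v⟩
      | edge => exact hx.elim
      | ghost => exact hx.elim
    · obtain ⟨y, hy, -, -, hxy⟩ := exists_letter (K := K) hLV hx
      rw [← hxy, op_g hLV y hy]
      exact ⟨Sys.X_mem_normals y hB, (rep K hLV).lin_X hy hB⟩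
  | zero => intro B hB; simp
  | add a b _ _ iha ihb =>
    intro B hB
    rw [map_add, LinearMap.add_apply, map_add, add_mul, (iha B hB).2, (ihb B hB).2]
    exact ⟨add_mem (iha B hB).1 (ihb B hB).1, rfl⟩
  | mul a b _ _ iha ihb =>
    intro B hB
    have hb := ihb B hB
    have hab := iha _ hb.1
    rw [map_mul, Module.End.mul_apply, hab.2, hb.2, mul_assoc]
    exact ⟨hab.1, rfl⟩
  | smul c a _ ih =>
    intro B hB
    rw [map_smul, LinearMap.smul_apply, map_smul, (ih B hB).2, smul_mul_assoc]
    exact ⟨Submodule.smul_mem _ _ (ih B hB).1, rfl⟩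

/-- The normal words span the Leavitt path algebra. -/
theorem exists_lin_eq {a : Ambient K H0 H1 s r} (ha : a ∈ LPAsub K H0 H1 s r) :
    ∃ A ∈ (sys s r hLV).normals K, (rep K hLV).lin A = a := by
  induction ha using NonUnitalAlgebra.adjoin_induction with
  | mem a ha =>
    obtain ⟨x, rfl⟩ := ha
    by_cases hx : IsVertexLetter x
    · cases x with
      | vertex v => exact ⟨Sys.e K [] v, Sys.e_mem_normals trivial, (rep K hLV).lin_e [] v⟩
      | edge => exact hx.elim
      | ghost => exact hx.elim
    · obtain ⟨y, hy, -, -, hxy⟩ := exists_letter (K := K) hLV hx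
      refine ⟨Sys.e K [y] ((sys s r hLV).rng y), Sys.e_mem_normals ⟨hy, rfl, by simp, trivial⟩, ?_⟩
      rw [Sys.Rep.lin_e, ← hxy]
      exact (rep K hLV).g_mul_p y hy
  | zero => exact ⟨0, zero_mem _, map_zero _⟩
  | add a b _ _ iha ihb =>
    obtain ⟨A, hA, rfl⟩ := iha
    obtain ⟨B, hB, rfl⟩ := ihb
    exact ⟨A + B, add_mem hA hB, map_add _ _ _⟩
  | mul a b ha _ _ ihb =>
    obtain ⟨B, hB, rfl⟩ := ihb
    exact ⟨_, op_mem_and_lin_op hLV ha B hB⟩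
  | smul c a _ ih =>
    obtain ⟨A, hA, rfl⟩ := ih
    exact ⟨c • A, Submodule.smul_mem _ _ hA, map_smul _ _ _⟩

/-- Some element of the algebra moves the vector `B` to a nonzero combination of normal words
starting at `u`. -/
def Reaches (B : Word (H1 × Bool) H0 →₀ K) (u : H0) : Prop :=
  ∃ z ∈ LPAsub K H0 H1 s r, op K hLV z B ≠ 0 ∧
    ∀ q ∈ (op K hLV z B).support, (sys s r hLV).start q.1 q.2 = u

theorem Reaches.step {B : Word (H1 × Bool) H0 →₀ K} (hB : B ∈ (sys s r hLV).normals K)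
    {x : HGen H0 H1 s r} (hx : ¬ IsVertexLetter x) (h : Reaches hLV B (letterRng x)) :
    Reaches hLV B (letterSrc x) := by
  obtain ⟨z, hz, h0, hst⟩ := h
  obtain ⟨y, hy, hsrc, hrng, hxy⟩ := exists_letter (K := K) hLV hx
  refine ⟨amb K H0 H1 s r x * z, mul_mem (amb_mem x) hz, ?_⟩
  rw [map_mul, ← hxy, op_g hLV y hy, Module.End.mul_apply]
  refine ⟨Sys.X_apply_ne_zero hy (op_mem_and_lin_op hLV hz B hB).1 (by rwa [hrng]) h0, ?_⟩
  rw [← hsrc, ← Sys.P_comp_X, Module.End.mul_apply]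
  exact Sys.start_eq_of_mem_support_P

theorem Reaches.path {B : Word (H1 × Bool) H0 →₀ K} (hB : B ∈ (sys s r hLV).normals K)
    {l : List (HGen H0 H1 s r)} (hl : IsDPath l) {x y : HGen H0 H1 s r} (hx : l.head? = some x)
    (hy : l.getLast? = some y) (h : Reaches hLV B (letterRng y)) :
    Reaches hLV B (letterSrc x) := by
  obtain ⟨v, rfl⟩ | ⟨-, hv, hc⟩ := hl
  · obtain rfl : HGen.vertex v = x := by simpa using hx
    obtain rfl : HGen.vertex v = y := by simpa using hy
    exact h
  · induction l generalizing x with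
    | nil => simp at hx
    | cons a l ih =>
      obtain rfl : a = x := by simpa using hx
      refine Reaches.step hLV hB (hv a (by simp)) ?_
      cases l with
      | nil =>
        obtain rfl : a = y := by simpa using hy
        exact h
      | cons b l =>
        have hc := List.isChain_cons_cons.1 hc
        rw [hc.1]
        exact ih rfl (by simpa using hy) (fun z hz => hv z (List.mem_cons_of_mem _ hz)) hc.2

end HLPA

open HLPA in
/-- **Corollary 7.13 (Corollary \ref{corlocval2}).** If the hypergraph `H` satisfies
Condition (LV) and is connected (for any `v, w ∈ H^0` there is a d-path from `v` to `w`),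
then `L_K(H)` is a prime ring. -/
theorem stmt_14 (K : Type) [Field K] (H0 H1 : Type) [Nonempty H0]
    (s r : H1 → List H0) (hs : ∀ h, s h ≠ []) (hr : ∀ h, r h ≠ [])
    (hLV : ∀ h : H1, 2 ≤ (s h).length ∧ 2 ≤ (r h).length)
    (hconn : ∀ v w : H0, ∃ l : List (HGen H0 H1 s r), IsDPath l ∧
      (∃ x, l.head? = some x ∧ letterSrc x = v) ∧
      (∃ y, l.getLast? = some y ∧ letterRng y = w)) :
    Nontrivial (LPA K H0 H1 s r) ∧
    ∀ x y : LPA K H0 H1 s r, (∀ z, x * z * y = 0) → x = 0 ∨ y = 0 := by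
  refine ⟨?_, ?_⟩
  · obtain ⟨v⟩ := ‹Nonempty H0›
    refine ⟨⟨vgen K v, 0, fun h => ?_⟩⟩
    have hv : (rep K hLV).lin (HalfEdge.Sys.e K [] v) ≠ 0 :=
      lin_ne_zero hLV (HalfEdge.Sys.e_mem_normals trivial) (Finsupp.single_ne_zero.2 one_ne_zero)
    rw [HalfEdge.Sys.Rep.lin_e] at hv
    exact hv (congrArg Subtype.val h)
  · rintro ⟨x, hx⟩ ⟨y, hy⟩ hxy
    obtain ⟨A, hA, rfl⟩ := exists_lin_eq hLV hx
    obtain ⟨B, hB, rfl⟩ := exists_lin_eq hLV hy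
    by_contra! hne
    have hA0 : A ≠ 0 := by
      rintro rfl
      exact hne.1 (Subtype.ext (map_zero _))
    have hB0 : B ≠ 0 := by
      rintro rfl
      exact hne.2 (Subtype.ext (map_zero _))
    obtain ⟨p, hp⟩ := Finsupp.support_nonempty_iff.2 hA0
    obtain ⟨q, hq⟩ := Finsupp.support_nonempty_iff.2 hB0
    obtain ⟨l, hl, ⟨a, ha, hau⟩, b, hb, hbv⟩ := hconn p.2 ((sys s r hLV).start q.1 q.2)
    have hreach : Reaches hLV B (letterRng b) := by
      refine ⟨amb K H0 H1 s r (.vertex (letterRng b)), amb_mem _, ?_⟩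
      rw [op_amb, opGen, hbv]
      exact ⟨HalfEdge.Sys.P_start_ne_zero hB hq, HalfEdge.Sys.start_eq_of_mem_support_P⟩
    obtain ⟨z, hz, hz0, hzu⟩ := hreach.path hLV hB hl ha hb
    rw [hau] at hzu
    have hzB := (op_mem_and_lin_op hLV hz B hB).1
    have hmain := HalfEdge.Sys.reg_lin_ne_zero hA hzB hzu ⟨p, hp, rfl⟩ hz0
    rw [← op_lin hLV hA] at hmain
    have hxzB := op_mem_and_lin_op hLV hx _ hzB
    refine lin_ne_zero hLV hxzB.1 hmain ?_
    rw [hxzB.2, (op_mem_and_lin_op hLV hz B hB).2, ← mul_assoc]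
    exact congrArg Subtype.val (hxy ⟨z, hz⟩)
end

section
/- Let H be a hypergraph satisfying Condition (LV) with H^1 ≠ ∅, and K a field. Then L_K(H) is not von Neumann regular: there exists x ∈ L_K(H) such that xyx ≠ x for every y ∈ L_K(H). -/
open scoped Classical

namespace HLPA

section Representation

open Polynomial

variable {A M : Type} [CommRing A] [AddCommGroup M] [Module A M]

/-- The `(i, j)` matrix entry of a linear map between finite powers of a module. -/
def entry {n m : ℕ} (e : (Fin n → M) →ₗ[A] (Fin m → M)) (i : Fin m) (j : Fin n) :
    Module.End A M :=
  LinearMap.proj i ∘ₗ e ∘ₗ LinearMap.single A (fun _ => M) j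

lemma entry_apply {n m : ℕ} (e : (Fin n → M) →ₗ[A] (Fin m → M)) (i : Fin m) (j : Fin n)
    (x : M) : entry e i j x = e (Pi.single j x) i := rfl

lemma sum_entry_mul_entry {n m l : ℕ} (e : (Fin n → M) →ₗ[A] (Fin m → M))
    (f : (Fin l → M) →ₗ[A] (Fin n → M)) (i : Fin m) (j : Fin l) :
    ∑ k, entry e i k * entry f k j = entry (e ∘ₗ f) i j := by
  ext x
  simp only [LinearMap.sum_apply, Module.End.mul_apply, entry_apply, LinearMap.comp_apply]
  rw [← Finset.sum_apply, ← map_sum, Finset.univ_sum_single]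

lemma entry_id {n : ℕ} (i j : Fin n) :
    entry (LinearMap.id : (Fin n → M) →ₗ[A] (Fin n → M)) i j = if i = j then 1 else 0 := by
  ext x
  rw [entry_apply, LinearMap.id_apply, Pi.single_apply]
  split_ifs <;> rfl

variable (A) in
/-- A finite nonempty power of `ℕ → A` is isomorphic to `ℕ → A`. -/
noncomputable def powEquiv (k : ℕ) : (Fin (k + 1) → ℕ → A) ≃ₗ[A] (ℕ → A) :=
  (LinearEquiv.curry A A (Fin (k + 1)) ℕ).symm ≪≫ₗ
    LinearEquiv.funCongrLeft A A (nonempty_equiv_of_countable (α := ℕ)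
      (β := Fin (k + 1) × ℕ)).some

/-- The automorphism `(x, y) ↦ (t x + y, x)` of `M × M`. -/
def shearSwap (t : A) : (M × M) ≃ₗ[A] (M × M) where
  toFun p := (t • p.1 + p.2, p.1)
  invFun p := (p.2, p.1 - t • p.2)
  map_add' p q := by
    ext <;> simp only [Prod.fst_add, Prod.snd_add, smul_add]
    abel
  map_smul' c p := by
    ext <;> simp [smul_comm t c]
  left_inv p := by ext <;> simp
  right_inv p := by ext <;> simp

lemma exists_equiv_entry_zero (t : A) {n m : ℕ} (hn : 2 ≤ n) (hm : 2 ≤ m) :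
    ∃ e : (Fin n → ℕ → A) ≃ₗ[A] (Fin m → ℕ → A),
      ∀ x, entry e.toLinearMap ⟨0, by omega⟩ ⟨0, by omega⟩ x = t • x := by
  obtain ⟨n, rfl⟩ := Nat.exists_eq_add_of_le' hn
  obtain ⟨m, rfl⟩ := Nat.exists_eq_add_of_le' hm
  refine ⟨(Fin.consLinearEquiv A (fun _ : Fin (n + 2) => ℕ → A)).symm ≪≫ₗ
    LinearEquiv.prodCongr (LinearEquiv.refl A _) (powEquiv A n) ≪≫ₗ shearSwap t ≪≫ₗ
    LinearEquiv.prodCongr (LinearEquiv.refl A _) (powEquiv A m).symm ≪≫ₗ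
    Fin.consLinearEquiv A (fun _ : Fin (m + 2) => ℕ → A), fun x => ?_⟩
  have h0 : (Fin.consLinearEquiv A (fun _ : Fin (n + 2) => ℕ → A)).symm (Pi.single 0 x) =
      (x, 0) := by
    rw [LinearEquiv.symm_apply_eq]
    ext i
    refine Fin.cases ?_ (fun i => ?_) i <;> simp [Fin.consLinearEquiv]
  simp only [entry_apply, LinearEquiv.coe_coe, LinearEquiv.trans_apply, Fin.zero_eta, h0]
  simp [shearSwap, Fin.consLinearEquiv]

lemma X_smul_mul_ne (K : Type) [Field K] (f g : Module.End K[X] (ℕ → K[X]))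
    (hf : ∀ x, f x = (X : K[X]) • x) : f * g * f ≠ f := by
  intro h
  have h1 := congrFun (LinearMap.congr_fun h (fun _ => 1)) 0
  simp only [Module.End.mul_apply, hf, map_smul, Pi.smul_apply, smul_eq_mul] at h1
  exact not_isUnit_X (IsUnit.of_mul_eq_one _ (mul_left_cancel₀ X_ne_zero h1))

section Corner

variable {V : Type}

/-- The endomorphism of `V → M` that acts as `f` from the coordinate `v` to the coordinate `u`
and is zero on all other coordinates. -/
noncomputable def corner (u v : V) : Module.End A M →+ Module.End A (V → M) where
  toFun f := LinearMap.single A (fun _ => M) u ∘ₗ f ∘ₗ LinearMap.proj v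
  map_zero' := by simp
  map_add' f g := by rw [LinearMap.add_comp, LinearMap.comp_add]

lemma corner_apply (u v : V) (f : Module.End A M) (x : V → M) :
    corner u v f x = Pi.single u (f (x v)) := rfl

lemma corner_mul_corner (u v w : V) (f g : Module.End A M) :
    corner u v f * corner v w g = corner u w (f * g) := by
  refine LinearMap.ext fun x => ?_
  simp [corner_apply]

lemma corner_mul_corner_of_ne {v v' : V} (hv : v ≠ v') (u w : V) (f g : Module.End A M) :
    corner u v f * corner v' w g = 0 := by
  refine LinearMap.ext fun x => ?_
  simp [corner_apply, hv]

end Corner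

variable {H0 H1 : Type} {s r : H1 → List H0}

/-- The action of the generators on `H0 → M` given by a family of isomorphisms between finite
powers of `M`. -/
noncomputable def genRep (e : ∀ h, (Fin (r h).length → M) ≃ₗ[A] (Fin (s h).length → M)) :
    HGen H0 H1 s r → Module.End A (H0 → M)
  | .vertex v => corner v v 1
  | .edge h i j => corner ((s h).get i) ((r h).get j) (entry (e h).toLinearMap i j)
  | .ghost h i j => corner ((r h).get j) ((s h).get i) (entry (e h).symm.toLinearMap j i)

variable (K : Type) [Field K] [Algebra K A] [Module K M] [IsScalarTower K A M]

lemma lift_genRep_eq_of_rel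
    (e : ∀ h, (Fin (r h).length → M) ≃ₗ[A] (Fin (s h).length → M))
    {a b : FreeAlgebra K (HGen H0 H1 s r)} (hab : Rel K H0 H1 s r a b) :
    FreeAlgebra.lift K (genRep e) a = FreeAlgebra.lift K (genRep e) b := by
  cases hab with
  | vtx u v =>
    by_cases huv : u = v
    · subst huv
      simp [genRep, corner_mul_corner]
    · simp [genRep, huv, corner_mul_corner_of_ne]
  | src_edge h i j =>
    simp only [map_mul, FreeAlgebra.lift_ι_apply, genRep, corner_mul_corner, one_mul]
  | edge_rng h i j =>
    simp only [map_mul, FreeAlgebra.lift_ι_apply, genRep, corner_mul_corner, mul_one]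
  | rng_ghost h i j =>
    simp only [map_mul, FreeAlgebra.lift_ι_apply, genRep, corner_mul_corner, one_mul]
  | ghost_src h i j =>
    simp only [map_mul, FreeAlgebra.lift_ι_apply, genRep, corner_mul_corner, mul_one]
  | cuntz1 h i i' =>
    simp only [map_sum, map_mul, FreeAlgebra.lift_ι_apply, genRep, corner_mul_corner]
    rw [← map_sum, sum_entry_mul_entry, LinearEquiv.comp_symm, entry_id]
    split_ifs with hi
    · subst hi
      simp [genRep]
    · simp
  | cuntz2 h j j' =>
    simp only [map_sum, map_mul, FreeAlgebra.lift_ι_apply, genRep, corner_mul_corner]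
    rw [← map_sum, sum_entry_mul_entry, LinearEquiv.symm_comp, entry_id]
    split_ifs with hj
    · subst hj
      simp [genRep]
    · simp

/-- The representation of the ambient algebra on `H0 → M` extending `genRep`. -/
noncomputable def ambientRep
    (e : ∀ h, (Fin (r h).length → M) ≃ₗ[A] (Fin (s h).length → M)) :
    Ambient K H0 H1 s r →ₐ[K] Module.End A (H0 → M) :=
  RingQuot.liftAlgHom K ⟨FreeAlgebra.lift K (genRep e), fun _ _ => lift_genRep_eq_of_rel K e⟩

lemma ambientRep_amb (e : ∀ h, (Fin (r h).length → M) ≃ₗ[A] (Fin (s h).length → M))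
    (g : HGen H0 H1 s r) : ambientRep K e (amb K H0 H1 s r g) = genRep e g := by
  rw [ambientRep, amb, RingQuot.liftAlgHom_mkAlgHom_apply, FreeAlgebra.lift_ι_apply]

end Representation

end HLPA

open HLPA in
/-- **Corollary 7.14 (Corollary \ref{corlocval3}).** If the hypergraph `H` satisfies
Condition (LV) and `H^1 ≠ ∅`, then `L_K(H)` is not von Neumann regular. -/
theorem stmt_15 (K : Type) [Field K] (H0 H1 : Type) [Nonempty H0] [Nonempty H1]
    (s r : H1 → List H0) (hs : ∀ h, s h ≠ []) (hr : ∀ h, r h ≠ [])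
    (hLV : ∀ h : H1, 2 ≤ (s h).length ∧ 2 ≤ (r h).length) :
    ∃ x : LPA K H0 H1 s r, ∀ y : LPA K H0 H1 s r, x * y * x ≠ x := by
  obtain ⟨h⟩ := ‹Nonempty H1›
  choose e he using fun h => exists_equiv_entry_zero (Polynomial.X : Polynomial K)
    (hLV h).2 (hLV h).1
  have h0s : 0 < (s h).length := List.length_pos_iff.2 (hs h)
  have h0r : 0 < (r h).length := List.length_pos_iff.2 (hr h)
  refine ⟨egen K h ⟨0, h0s⟩ ⟨0, h0r⟩, fun y hy => ?_⟩
  have h1 := congrArg (fun z : LPA K H0 H1 s r => ambientRep K e z.1) hy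
  change ambientRep K e (amb K H0 H1 s r (.edge h ⟨0, h0s⟩ ⟨0, h0r⟩) * y.1 *
    amb K H0 H1 s r (.edge h ⟨0, h0s⟩ ⟨0, h0r⟩)) =
    ambientRep K e (amb K H0 H1 s r (.edge h ⟨0, h0s⟩ ⟨0, h0r⟩)) at h1
  rw [map_mul, map_mul, ambientRep_amb, genRep] at h1
  set u := (s h).get ⟨0, h0s⟩
  set v := (r h).get ⟨0, h0r⟩
  refine X_smul_mul_ne K _ (LinearMap.proj v ∘ₗ ambientRep K e y.1 ∘ₗ
    LinearMap.single _ (fun _ => ℕ → Polynomial K) u) (he h) (LinearMap.ext fun z => ?_)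
  have h2 := congrFun (LinearMap.congr_fun h1 (Pi.single v z)) u
  simp only [Module.End.mul_apply, corner_apply, Pi.single_eq_same] at h2
  exact h2
end
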